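/- arXiv:2311.09332 — 8 statements merged into one kernel-verified Lean document; each statement's English description precedes it below -/
import Mathlib

section
/- Let f : ℝ → ℝ be infinitely differentiable and let x ∈ ℝ. Define H(y, Δx) = f(y) − (1/24)·f″(y)·Δx² + (7/5760)·f⁽⁴⁾(y)·Δx⁴. Then (H(x + Δx/2, Δx) − H(x − Δx/2, Δx))/Δx = f′(x) + O(Δx⁶) as Δx → 0⁺. -/
lemma weno_aux (g : ℝ → ℝ) (hg : ContDiff ℝ (⊤ : ℕ∞) g) (x : ℝ) (n : ℕ) :
    ∃ C > (0 : ℝ), ∃ δ > (0 : ℝ), ∀ h : ℝ, |h| < δ →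
      |g (x + h) - ∑ k ∈ Finset.range n, iteratedDeriv k g x / (k.factorial : ℝ) * h ^ k|
        ≤ C * |h| ^ n := by
  have hn : ContDiff ℝ n g := hg.of_le (by exact_mod_cast le_top)
  have h1 := (taylor_isLittleO_univ (x₀ := x) hn).bound (zero_lt_one)
  rw [Metric.eventually_nhds_iff] at h1
  obtain ⟨δ, hδ, h1⟩ := h1
  refine ⟨1 + |iteratedDeriv n g x / (n.factorial : ℝ)|, by positivity, δ, hδ, fun h hh => ?_⟩
  have h2 := @h1 (x + h) (by simpa [Real.dist_eq] using hh)
  rw [taylor_within_apply, Finset.sum_range_succ] at h2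
  simp only [iteratedDerivWithin_univ, add_sub_cancel_left, smul_eq_mul, Real.norm_eq_abs,
    one_mul, abs_pow] at h2
  have h3 : ∑ k ∈ Finset.range n, iteratedDeriv k g x / (k.factorial : ℝ) * h ^ k
      = ∑ k ∈ Finset.range n, ((k.factorial : ℝ))⁻¹ * h ^ k * iteratedDeriv k g x :=
    Finset.sum_congr rfl fun k _ => by ring
  rw [h3]
  set S := ∑ k ∈ Finset.range n, ((k.factorial : ℝ))⁻¹ * h ^ k * iteratedDeriv k g x
  have h4 : g (x + h) - S = (g (x + h) - (S + ((n.factorial : ℝ))⁻¹ * h ^ n * iteratedDeriv n g x))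
      + iteratedDeriv n g x / (n.factorial : ℝ) * h ^ n := by ring
  rw [h4]
  refine (abs_add_le _ _).trans ?_
  rw [abs_mul, abs_pow, add_mul, one_mul]
  gcongr

lemma weno_iter (f : ℝ → ℝ) (m k : ℕ) :
    iteratedDeriv k (iteratedDeriv m f) = iteratedDeriv (k + m) f := by
  simp only [iteratedDeriv_eq_iterate, Function.iterate_add_apply]

lemma weno_smooth (f : ℝ → ℝ) (hf : ContDiff ℝ (⊤ : ℕ∞) f) (m : ℕ) :
    ContDiff ℝ (⊤ : ℕ∞) (iteratedDeriv m f) := by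
  rw [iteratedDeriv_eq_iterate]
  exact hf.iterate_deriv m

/-- For smooth `f` and
`H(y, Δx) = f(y) − (1/24)·f″(y)·Δx² + (7/5760)·f⁽⁴⁾(y)·Δx⁴`, the centered flux
difference `(H(x+Δx/2,Δx) − H(x−Δx/2,Δx))/Δx` equals `f′(x) + O(Δx⁶)` as `Δx → 0⁺`. -/
theorem weno_flux_taylor_sixth_order
    (f : ℝ → ℝ) (hf : ContDiff ℝ (⊤ : ℕ∞) f) (x : ℝ)
    (H : ℝ → ℝ → ℝ)
    (hH : ∀ y Δx : ℝ, H y Δx =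
      f y - (1 / 24) * iteratedDeriv 2 f y * Δx ^ 2
          + (7 / 5760) * iteratedDeriv 4 f y * Δx ^ 4) :
    ∃ C > (0 : ℝ), ∃ δ > (0 : ℝ), ∀ Δx : ℝ, 0 < Δx → Δx < δ →
      |(H (x + Δx / 2) Δx - H (x - Δx / 2) Δx) / Δx - deriv f x| ≤ C * Δx ^ 6 := by
  obtain ⟨A, hA, a, ha, h0⟩ := weno_aux f hf x 7
  obtain ⟨B, hB, b, hb, h2⟩ := weno_aux _ (weno_smooth f hf 2) x 5
  obtain ⟨D, hD, d, hd, h4⟩ := weno_aux _ (weno_smooth f hf 4) x 3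
  refine ⟨A + B + D, by positivity, min a (min b d), by positivity, fun t ht htd => ?_⟩
  rw [lt_min_iff, lt_min_iff] at htd
  obtain ⟨hta, htb, htd⟩ := htd
  have e1 : |t / 2| = t / 2 := abs_of_pos (by positivity)
  have e2 : |-(t / 2)| = t / 2 := by rw [abs_neg, e1]
  have p0 := h0 (t / 2) (by rw [e1]; linarith)
  have m0 := h0 (-(t / 2)) (by rw [e2]; linarith)
  have p2 := h2 (t / 2) (by rw [e1]; linarith)
  have m2 := h2 (-(t / 2)) (by rw [e2]; linarith)
  have p4 := h4 (t / 2) (by rw [e1]; linarith)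
  have m4 := h4 (-(t / 2)) (by rw [e2]; linarith)
  simp only [e1, e2, weno_iter, Finset.sum_range_succ, Finset.sum_range_zero, Nat.factorial,
    ← sub_eq_add_neg] at p0 m0 p2 m2 p4 m4
  norm_num at p0 m0 p2 m2 p4 m4
  rw [hH, hH]
  generalize f (x + t / 2) = F1 at *
  generalize f (x - t / 2) = F2 at *
  generalize iteratedDeriv 2 f (x + t / 2) = G1 at *
  generalize iteratedDeriv 2 f (x - t / 2) = G2 at *
  generalize iteratedDeriv 4 f (x + t / 2) = K1 at *
  generalize iteratedDeriv 4 f (x - t / 2) = K2 at *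
  have t2 : 0 < t ^ 2 := by positivity
  have t4 : 0 < t ^ 4 := by positivity
  have AT : 0 < A * t ^ 7 := by positivity
  have BT : 0 < B * t ^ 7 := by positivity
  have DT : 0 < D * t ^ 7 := by positivity
  rw [abs_le] at p0 m0 p2 m2 p4 m4
  have key : ∀ N : ℝ, |N - t * deriv f x| ≤ (A + B + D) * t ^ 7 →
      |N / t - deriv f x| ≤ (A + B + D) * t ^ 6 := by
    intro N hN
    have : N / t - deriv f x = (N - t * deriv f x) / t := by field_simp
    rw [this, abs_div, abs_of_pos ht, div_le_iff₀ ht]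
    calc _ ≤ _ := hN
      _ = _ := by ring
  apply key
  have q1 := mul_le_mul_of_nonneg_right p2.1 t2.le
  have q2 := mul_le_mul_of_nonneg_right p2.2 t2.le
  have q3 := mul_le_mul_of_nonneg_right m2.1 t2.le
  have q4 := mul_le_mul_of_nonneg_right m2.2 t2.le
  have q5 := mul_le_mul_of_nonneg_right p4.1 t4.le
  have q6 := mul_le_mul_of_nonneg_right p4.2 t4.le
  have q7 := mul_le_mul_of_nonneg_right m4.1 t4.le
  have q8 := mul_le_mul_of_nonneg_right m4.2 t4.le
  obtain ⟨p01, p02⟩ := p0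
  obtain ⟨m01, m02⟩ := m0
  clear p2 m2 p4 m4
  rw [abs_le]
  constructor <;> linarith
end

section
/- Let f : ℝ → ℝ be infinitely differentiable and let x ∈ ℝ. With (A₀, A₁, A₂) = (−1/4, 1/12, −1/12), for each k ∈ {0,1,2} the WENO reconstructions satisfy, as Δx → 0⁺: f̂^k(x,Δx) = f(x) + (1/2)·f′(x)·Δx + (1/12)·f″(x)·Δx² + A_k·f‴(x)·Δx³ + O(Δx⁴) and f̂^{k,−}(x,Δx) = f(x) − (1/2)·f′(x)·Δx + (1/12)·f″(x)·Δx² + A_k·f‴(x)·Δx³ + O(Δx⁴); that is, the third-order deviation coefficient A_k is the same at both cell boundaries. -/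
/-- The three third-order WENO reconstructions at the right cell boundary. -/
noncomputable def wenoFhat (f : ℝ → ℝ) (x Δx : ℝ) : Fin 3 → ℝ
  | 0 => (2 * f (x - 2 * Δx) - 7 * f (x - Δx) + 11 * f x) / 6
  | 1 => (-f (x - Δx) + 5 * f x + 2 * f (x + Δx)) / 6
  | 2 => (2 * f x + 5 * f (x + Δx) - f (x + 2 * Δx)) / 6

/-- The third-order deviation coefficients `(A₀, A₁, A₂) = (−1/4, 1/12, −1/12)`. -/
noncomputable def wenoA : Fin 3 → ℝ
  | 0 => -1 / 4
  | 1 => 1 / 12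
  | 2 => -1 / 12

theorem weno_taylor_aux (f : ℝ → ℝ) (hf : ContDiff ℝ (⊤ : ℕ∞) f) (x : ℝ) :
    ∃ C > (0 : ℝ), ∃ δ > (0 : ℝ), ∀ h : ℝ, |h| < δ →
      |f (x + h) - (f x + deriv f x * h + iteratedDeriv 2 f x * h ^ 2 / 2
        + iteratedDeriv 3 f x * h ^ 3 / 6)| ≤ C * h ^ 4 := by
  have h4 : ContDiff ℝ (4 : ℕ) f := contDiff_infty.1 hf 4
  have h := (taylor_isLittleO_univ (x₀ := x) h4).bound (c := 1) one_pos
  obtain ⟨δ, hδ, H⟩ := Metric.eventually_nhds_iff.1 h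
  refine ⟨1 + |iteratedDeriv 4 f x| / 24, by positivity, δ, hδ, fun t ht => ?_⟩
  have h1 := H (y := x + t) (by simpa [Real.dist_eq] using ht)
  have e4 : |t ^ 4| = t ^ 4 := abs_of_nonneg (by positivity)
  simp only [taylorWithinEval_succ, taylor_within_zero_eval, iteratedDerivWithin_univ,
    Real.norm_eq_abs, add_sub_cancel_left, smul_eq_mul, e4, iteratedDeriv_one, zero_add,
    one_mul] at h1
  norm_num [Nat.factorial] at h1
  have h2 : |iteratedDeriv 4 f x * t ^ 4 / 24| = |iteratedDeriv 4 f x| / 24 * t ^ 4 := by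
    rw [abs_div, abs_mul, e4]; norm_num; ring
  have h3 := abs_le.1 h1
  have h5 := abs_le.1 h2.le
  rw [abs_le]
  constructor <;> linarith [h3.1, h3.2, h5.1, h5.2]

/-- Taylor expansions of the WENO reconstructions at both cell
boundaries: `f̂^k(x,Δx) = f(x) + (1/2)f′(x)Δx + (1/12)f″(x)Δx² + A_k f‴(x)Δx³ + O(Δx⁴)`
and `f̂^{k,−}(x,Δx) = f(x) − (1/2)f′(x)Δx + (1/12)f″(x)Δx² + A_k f‴(x)Δx³ + O(Δx⁴)`,
with the same coefficient `A_k` at both boundaries. -/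
theorem weno_reconstruction_taylor
    (f : ℝ → ℝ) (hf : ContDiff ℝ (⊤ : ℕ∞) f) (x : ℝ) :
    ∀ k : Fin 3, ∃ C > (0 : ℝ), ∃ δ > (0 : ℝ), ∀ Δx : ℝ, 0 < Δx → Δx < δ →
      |wenoFhat f x Δx k -
        (f x + (1 / 2) * deriv f x * Δx + (1 / 12) * iteratedDeriv 2 f x * Δx ^ 2
          + wenoA k * iteratedDeriv 3 f x * Δx ^ 3)| ≤ C * Δx ^ 4 ∧
      |wenoFhat f (x - Δx) Δx k -
        (f x - (1 / 2) * deriv f x * Δx + (1 / 12) * iteratedDeriv 2 f x * Δx ^ 2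
          + wenoA k * iteratedDeriv 3 f x * Δx ^ 3)| ≤ C * Δx ^ 4 := by
  obtain ⟨C, hC, δ, hδ, H⟩ := weno_taylor_aux f hf x
  intro k
  refine ⟨100 * C, by positivity, δ / 3, by positivity, fun d hd hdδ => ?_⟩
  have key : ∀ c : ℝ, |c| ≤ 3 → |f (x + c * d) - (f x + deriv f x * (c * d)
      + iteratedDeriv 2 f x * (c * d) ^ 2 / 2
        + iteratedDeriv 3 f x * (c * d) ^ 3 / 6)| ≤ C * (c * d) ^ 4 := by
    intro c hc
    apply H
    rw [abs_mul, abs_of_pos hd]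
    nlinarith
  have a1 := abs_le.1 (key (-3) (by norm_num))
  have a2 := abs_le.1 (key (-2) (by norm_num))
  have a3 := abs_le.1 (key (-1) (by norm_num))
  have a4 := abs_le.1 (key 1 (by norm_num))
  have a5 := abs_le.1 (key 2 (by norm_num))
  rw [show x + -3 * d = x - d - 2 * d by ring] at a1
  rw [show x + -2 * d = x - 2 * d by ring] at a2
  rw [show x + -1 * d = x - d by ring] at a3
  rw [show x + 1 * d = x + d by ring] at a4
  have b2 : x - d - d = x - 2 * d := by ring
  have b3 : x - d + d = x := by ring
  have b4 : x - d + 2 * d = x + d := by ring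
  have hp : 0 < C * d ^ 4 := by positivity
  obtain ⟨a1, a1'⟩ := a1
  obtain ⟨a2, a2'⟩ := a2
  obtain ⟨a3, a3'⟩ := a3
  obtain ⟨a4, a4'⟩ := a4
  obtain ⟨a5, a5'⟩ := a5
  fin_cases k <;> simp only [wenoFhat, wenoA, b2, b3, b4, abs_le] <;>
    refine ⟨⟨?_, ?_⟩, ?_, ?_⟩ <;> linarith
end

section
/- Let f : ℝ → ℝ be infinitely differentiable and let x ∈ ℝ. Then, as Δx → 0⁺ (all derivatives evaluated at x): β₀⁺(x,Δx) = (f′)²Δx² + ((13/12)(f″)² − (2/3)f′f‴)Δx⁴ − ((13/6)f″f‴ − (1/2)f′f⁽⁴⁾)Δx⁵ + ((43/36)(f‴)² + (91/72)f″f⁽⁴⁾ − (7/30)f′f⁽⁵⁾)Δx⁶ + O(Δx⁷); β₁⁺(x,Δx) = (f′)²Δx² + ((13/12)(f″)² + (1/3)f′f‴)Δx⁴ + ((1/36)(f‴)² + (13/72)f″f⁽⁴⁾ + (1/60)f′f⁽⁵⁾)Δx⁶ + O(Δx⁸); β₂⁺(x,Δx) = (f′)²Δx² + ((13/12)(f″)²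 − (2/3)f′f‴)Δx⁴ + ((13/6)f″f‴ − (1/2)f′f⁽⁴⁾)Δx⁵ + ((43/36)(f‴)² + (91/72)f″f⁽⁴⁾ − (7/30)f′f⁽⁵⁾)Δx⁶ + O(Δx⁷). -/
/-- The Jiang--Shu smoothness indicators `β₀, β₁, β₂`. -/
noncomputable def wenoBeta (f : ℝ → ℝ) (x Δx : ℝ) : Fin 3 → ℝ
  | 0 => (1 / 4) * (f (x - 2 * Δx) - 4 * f (x - Δx) + 3 * f x) ^ 2
       + (13 / 12) * (f (x - 2 * Δx) - 2 * f (x - Δx) + f x) ^ 2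
  | 1 => (1 / 4) * (f (x + Δx) - f (x - Δx)) ^ 2
       + (13 / 12) * (f (x - Δx) - 2 * f x + f (x + Δx)) ^ 2
  | 2 => (1 / 4) * (3 * f x - 4 * f (x + Δx) + f (x + 2 * Δx)) ^ 2
       + (13 / 12) * (f x - 2 * f (x + Δx) + f (x + 2 * Δx)) ^ 2

lemma taylor_aux (f : ℝ → ℝ) (hf : ContDiff ℝ (⊤ : ℕ∞) f) (x : ℝ) :
    ∃ K : ℝ, 0 ≤ K ∧ ∃ δ > (0 : ℝ), ∀ t : ℝ, |t| < δ → ∃ r : ℝ, |r| ≤ K ∧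
      f (x + t) = f x + deriv f x * t + iteratedDeriv 2 f x / 2 * t ^ 2
        + iteratedDeriv 3 f x / 6 * t ^ 3 + iteratedDeriv 4 f x / 24 * t ^ 4
        + iteratedDeriv 5 f x / 120 * t ^ 5 + iteratedDeriv 6 f x / 720 * t ^ 6 + r * t ^ 7 := by
  have h := taylor_isLittleO_univ (f := f) (x₀ := x) (n := 7) (hf.of_le (WithTop.coe_le_coe.2 (le_top : ((7 : ℕ) : ℕ∞) ≤ ⊤)))
  have h1 := h.bound (c := 1) one_pos
  rw [Metric.eventually_nhds_iff] at h1
  obtain ⟨δ, hδ, H⟩ := h1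
  refine ⟨1 + |iteratedDeriv 7 f x / 5040|, by positivity, δ, hδ, fun t ht => ?_⟩
  have H1 := @H (x + t) (by simpa [Real.dist_eq] using ht)
  simp only [taylor_within_apply, Finset.sum_range_succ, Finset.sum_range_zero, add_sub_cancel_left,
    iteratedDerivWithin_univ, Real.norm_eq_abs, smul_eq_mul, iteratedDeriv_zero, iteratedDeriv_one,
    Nat.factorial] at H1
  norm_num at H1
  by_cases h0 : t = 0
  · subst h0
    exact ⟨0, by simp; positivity, by simp⟩
  set P := f x + deriv f x * t + iteratedDeriv 2 f x / 2 * t ^ 2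
        + iteratedDeriv 3 f x / 6 * t ^ 3 + iteratedDeriv 4 f x / 24 * t ^ 4
        + iteratedDeriv 5 f x / 120 * t ^ 5 + iteratedDeriv 6 f x / 720 * t ^ 6 with hP
  have h7 : t ^ 7 ≠ 0 := pow_ne_zero _ h0
  refine ⟨(f (x + t) - P - iteratedDeriv 7 f x / 5040 * t ^ 7) / t ^ 7
    + iteratedDeriv 7 f x / 5040, ?_, ?_⟩
  · refine (abs_add_le _ _).trans (add_le_add_left ?_ _)
    rw [abs_div, abs_pow, div_le_one (by positivity)]
    refine le_trans (le_of_eq ?_) H1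
    congr 1
    rw [hP]
    ring
  · field_simp
    ring

lemma bd_aux (G : ℝ × ℝ × ℝ → ℝ) (hG : Continuous G) (K : ℝ) :
    ∃ C : ℝ, ∀ h u v : ℝ, 0 < h → h < 1 → |u| ≤ K → |v| ≤ K → |G (h, u, v)| ≤ C := by
  obtain ⟨C, hC⟩ := ((isCompact_Icc (a := (0 : ℝ)) (b := 1)).prod
    ((isCompact_Icc (a := -K) (b := K)).prod (isCompact_Icc (a := -K) (b := K)))).exists_bound_of_continuousOn
    hG.continuousOn
  refine ⟨C, fun h u v h0 h1 hu hv => hC (h, u, v) ?_⟩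
  exact ⟨⟨h0.le, h1.le⟩, abs_le.1 hu, abs_le.1 hv⟩

/-- remainder for the one-sided stencils -/
lemma side_aux (a c3 c4 c5 a6 b2 b3 b4 b5 b6 K : ℝ) :
    ∃ C : ℝ, ∀ h u v : ℝ, 0 < h → h < 1 → |u| ≤ K → |v| ≤ K →
      |((1 / 4) * (2 * a * h + c3 * h ^ 3 + c4 * h ^ 4 + c5 * h ^ 5 + a6 * h ^ 6 + u * h ^ 7) ^ 2
        + (13 / 12) * (b2 * h ^ 2 + b3 * h ^ 3 + b4 * h ^ 4 + b5 * h ^ 5 + b6 * h ^ 6 + v * h ^ 7) ^ 2)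
        - (a ^ 2 * h ^ 2 + (a * c3 + 13 / 12 * b2 ^ 2) * h ^ 4
          + (a * c4 + 13 / 6 * b2 * b3) * h ^ 5
          + (a * c5 + c3 ^ 2 / 4 + 13 / 12 * (b3 ^ 2 + 2 * b2 * b4)) * h ^ 6)| ≤ C * h ^ 7 := by
  obtain ⟨C, hC⟩ := bd_aux (fun p => (1 / 4) * (4 * a * (a6 + p.2.1 * p.1) + 2 * c3 * c4
      + p.1 * (c4 ^ 2 + 2 * c3 * c5) + p.1 ^ 2 * (2 * c3 * (a6 + p.2.1 * p.1) + 2 * c4 * c5)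
      + p.1 ^ 3 * (c5 ^ 2 + 2 * c4 * (a6 + p.2.1 * p.1)) + p.1 ^ 4 * (2 * c5 * (a6 + p.2.1 * p.1))
      + p.1 ^ 5 * (a6 + p.2.1 * p.1) ^ 2)
      + (13 / 12) * (2 * b3 * b4 + 2 * b2 * (b5 + b6 * p.1 + p.2.2 * p.1 ^ 2)
      + p.1 * (b4 ^ 2 + 2 * b3 * (b5 + b6 * p.1 + p.2.2 * p.1 ^ 2))
      + p.1 ^ 2 * (2 * b4 * (b5 + b6 * p.1 + p.2.2 * p.1 ^ 2))
      + p.1 ^ 3 * (b5 + b6 * p.1 + p.2.2 * p.1 ^ 2) ^ 2)) (by fun_prop) K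
  refine ⟨C, fun h u v h0 h1 hu hv => ?_⟩
  have := mul_le_mul_of_nonneg_right (hC h u v h0 h1 hu hv) (pow_nonneg h0.le 7)
  refine le_trans (le_of_eq ?_) this
  refine Eq.trans ?_ ((abs_mul _ _).trans (congrArg _ (abs_of_nonneg (pow_nonneg h0.le 7))))
  congr 1
  ring

/-- remainder for the central stencil -/
lemma mid_aux (a c3 c5 b2 b4 b6 K : ℝ) :
    ∃ C : ℝ, ∀ h u v : ℝ, 0 < h → h < 1 → |u| ≤ K → |v| ≤ K →
      |((1 / 4) * (2 * a * h + c3 * h ^ 3 + c5 * h ^ 5 + u * h ^ 7) ^ 2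
        + (13 / 12) * (b2 * h ^ 2 + b4 * h ^ 4 + b6 * h ^ 6 + v * h ^ 7) ^ 2)
        - (a ^ 2 * h ^ 2 + (a * c3 + 13 / 12 * b2 ^ 2) * h ^ 4
          + (a * c5 + c3 ^ 2 / 4 + 13 / 12 * (2 * b2 * b4)) * h ^ 6)| ≤ C * h ^ 8 := by
  obtain ⟨C, hC⟩ := bd_aux (fun p => (1 / 4) * (4 * a * p.2.1 + 2 * c3 * c5
      + p.1 ^ 2 * (c5 ^ 2 + 2 * c3 * p.2.1) + p.1 ^ 4 * (2 * c5 * p.2.1)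
      + p.1 ^ 6 * p.2.1 ^ 2)
      + (13 / 12) * (b4 ^ 2 + 2 * b2 * (b6 + p.2.2 * p.1)
      + p.1 ^ 2 * (2 * b4 * (b6 + p.2.2 * p.1))
      + p.1 ^ 4 * (b6 + p.2.2 * p.1) ^ 2)) (by fun_prop) K
  refine ⟨C, fun h u v h0 h1 hu hv => ?_⟩
  have := mul_le_mul_of_nonneg_right (hC h u v h0 h1 hu hv) (pow_nonneg h0.le 8)
  refine le_trans (le_of_eq ?_) this
  refine Eq.trans ?_ ((abs_mul _ _).trans (congrArg _ (abs_of_nonneg (pow_nonneg h0.le 8))))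
  congr 1
  ring

/-- Taylor expansions of the right-boundary smoothness indicators
`β_k⁺(x,Δx) = β_k(x,Δx)` as `Δx → 0⁺` (derivatives evaluated at `x`). -/
theorem weno_beta_plus_taylor
    (f : ℝ → ℝ) (hf : ContDiff ℝ (⊤ : ℕ∞) f) (x : ℝ) :
    ∃ C > (0 : ℝ), ∃ δ > (0 : ℝ), ∀ Δx : ℝ, 0 < Δx → Δx < δ →
      |wenoBeta f x Δx 0 -
        ((deriv f x) ^ 2 * Δx ^ 2
          + ((13 / 12) * (iteratedDeriv 2 f x) ^ 2
              - (2 / 3) * deriv f x * iteratedDeriv 3 f x) * Δx ^ 4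
          - ((13 / 6) * iteratedDeriv 2 f x * iteratedDeriv 3 f x
              - (1 / 2) * deriv f x * iteratedDeriv 4 f x) * Δx ^ 5
          + ((43 / 36) * (iteratedDeriv 3 f x) ^ 2
              + (91 / 72) * iteratedDeriv 2 f x * iteratedDeriv 4 f x
              - (7 / 30) * deriv f x * iteratedDeriv 5 f x) * Δx ^ 6)| ≤ C * Δx ^ 7 ∧
      |wenoBeta f x Δx 1 -
        ((deriv f x) ^ 2 * Δx ^ 2
          + ((13 / 12) * (iteratedDeriv 2 f x) ^ 2
              + (1 / 3) * deriv f x * iteratedDeriv 3 f x) * Δx ^ 4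
          + ((1 / 36) * (iteratedDeriv 3 f x) ^ 2
              + (13 / 72) * iteratedDeriv 2 f x * iteratedDeriv 4 f x
              + (1 / 60) * deriv f x * iteratedDeriv 5 f x) * Δx ^ 6)| ≤ C * Δx ^ 8 ∧
      |wenoBeta f x Δx 2 -
        ((deriv f x) ^ 2 * Δx ^ 2
          + ((13 / 12) * (iteratedDeriv 2 f x) ^ 2
              - (2 / 3) * deriv f x * iteratedDeriv 3 f x) * Δx ^ 4
          + ((13 / 6) * iteratedDeriv 2 f x * iteratedDeriv 3 f x
              - (1 / 2) * deriv f x * iteratedDeriv 4 f x) * Δx ^ 5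
          + ((43 / 36) * (iteratedDeriv 3 f x) ^ 2
              + (91 / 72) * iteratedDeriv 2 f x * iteratedDeriv 4 f x
              - (7 / 30) * deriv f x * iteratedDeriv 5 f x) * Δx ^ 6)| ≤ C * Δx ^ 7 := by
  obtain ⟨K, hK, δ, hδ, T⟩ := taylor_aux f hf x
  set d1 := deriv f x
  set d2 := iteratedDeriv 2 f x
  set d3 := iteratedDeriv 3 f x
  set d4 := iteratedDeriv 4 f x
  set d5 := iteratedDeriv 5 f x
  set d6 := iteratedDeriv 6 f x
  obtain ⟨C0, H0⟩ := side_aux d1 (-(2 / 3) * d3) (1 / 2 * d4) (-(7 / 30) * d5) (60 / 720 * d6)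
    d2 (-d3) (7 / 12 * d4) (-(30 / 120) * d5) (62 / 720 * d6) (132 * K)
  obtain ⟨C1, H1⟩ := mid_aux d1 (d3 / 3) (d5 / 60) d2 (d4 / 12) (d6 / 360) (132 * K)
  obtain ⟨C2, H2⟩ := side_aux (-d1) (2 / 3 * d3) (1 / 2 * d4) (7 / 30 * d5) (60 / 720 * d6)
    d2 d3 (7 / 12 * d4) (30 / 120 * d5) (62 / 720 * d6) (132 * K)
  refine ⟨|C0| + |C1| + |C2| + 1, by positivity, min 1 (δ / 2), by positivity, fun h h0 hh => ?_⟩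
  have hh1 := lt_of_lt_of_le hh (min_le_left _ _)
  have hh2 := lt_of_lt_of_le hh (min_le_right _ _)
  obtain ⟨r1, hr1, e1⟩ := T h (by rw [abs_of_pos h0]; linarith)
  obtain ⟨r2, hr2, e2⟩ := T (2 * h) (by rw [abs_of_pos (by linarith)]; linarith)
  obtain ⟨s1, hs1, g1⟩ := T (-h) (by rw [abs_neg, abs_of_pos h0]; linarith)
  obtain ⟨s2, hs2, g2⟩ := T (-(2 * h)) (by rw [abs_neg, abs_of_pos (by linarith)]; linarith)
  rw [← sub_eq_add_neg] at g1 g2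
  rw [abs_le] at hr1 hr2 hs1 hs2
  have p7 : 0 ≤ h ^ 7 := by positivity
  have p8 : 0 ≤ h ^ 8 := by positivity
  have n0 := abs_nonneg C0
  have n1 := abs_nonneg C1
  have n2 := abs_nonneg C2
  have l0 := le_abs_self C0
  have l1 := le_abs_self C1
  have l2 := le_abs_self C2
  refine ⟨?_, ?_, ?_⟩
  · have := H0 h (-128 * s2 + 4 * s1) (-128 * s2 + 2 * s1) h0 hh1
      (by rw [abs_le]; constructor <;> linarith) (by rw [abs_le]; constructor <;> linarith)
    refine le_trans (le_of_eq ?_) (this.trans (mul_le_mul_of_nonneg_right (by linarith) p7))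
    simp only [wenoBeta]
    rw [g1, g2]
    congr 1
    ring
  · have := H1 h (r1 + s1) (r1 - s1) h0 hh1
      (by rw [abs_le]; constructor <;> linarith) (by rw [abs_le]; constructor <;> linarith)
    refine le_trans (le_of_eq ?_) (this.trans (mul_le_mul_of_nonneg_right (by linarith) p8))
    simp only [wenoBeta]
    rw [g1, e1]
    congr 1
    ring
  · have := H2 h (128 * r2 - 4 * r1) (128 * r2 - 2 * r1) h0 hh1
      (by rw [abs_le]; constructor <;> linarith) (by rw [abs_le]; constructor <;> linarith)
    refine le_trans (le_of_eq ?_) (this.trans (mul_le_mul_of_nonneg_right (by linarith) p7))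
    simp only [wenoBeta]
    rw [e1, e2]
    congr 1
    ring
end

section
/- Let f : ℝ → ℝ be infinitely differentiable and let x ∈ ℝ. Then, as Δx → 0⁺ (all derivatives evaluated at x): β₀⁻(x,Δx) = (f′)²Δx² − 2f′f″Δx³ + ((25/12)(f″)² + (1/3)f′f‴)Δx⁴ − ((14/3)f″f‴ − (5/6)f′f⁽⁴⁾)Δx⁵ + ((157/36)(f‴)² + (265/72)f″f⁽⁴⁾ − (59/60)f′f⁽⁵⁾)Δx⁶ + O(Δx⁷); β₁⁻(x,Δx) = (f′)²Δx² − 2f′f″Δx³ + ((25/12)(f″)² + (4/3)f′f‴)Δx⁴ − ((7/2)f″f‴ + (2/3)f′f⁽⁴⁾)Δx⁵ + ((55/36)(f‴)² + (139/72)f″f⁽⁴⁾ + (4/15)f′f⁽⁵⁾)Δx⁶ + O(Δx⁷); β₂⁻(x,Δx) = (f′)²Δx² − 2f′f″Δx³ + ((25/12)(f″)² + (1/3)f′f‴)Δx⁴ − ((1/3)f″f‴ + (1/6)f′f⁽⁴⁾)Δx⁵ + ((1/36)(f‴)² + (25/72)f″f⁽⁴⁾ + (1/60)f′f⁽⁵⁾)Δx⁶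 + O(Δx⁷). -/
lemma aux_taylor (f : ℝ → ℝ) (hf : ContDiff ℝ (⊤ : ℕ∞) f) (x : ℝ) :
    ∃ M : ℝ, 0 ≤ M ∧ ∀ h : ℝ, |h| ≤ 3 → ∃ r : ℝ, |r| ≤ M ∧
      f (x + h) = f x + deriv f x * h + iteratedDeriv 2 f x / 2 * h ^ 2
        + iteratedDeriv 3 f x / 6 * h ^ 3 + iteratedDeriv 4 f x / 24 * h ^ 4
        + iteratedDeriv 5 f x / 120 * h ^ 5 + r * h ^ 6 := by
  have hc : Continuous (iteratedDeriv 6 f) :=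
    (contDiff_infty.1 hf 6).continuous_iteratedDeriv 6 (by norm_num)
  obtain ⟨M, hM⟩ := (isCompact_Icc (a := x - 3) (b := x + 3)).exists_bound_of_continuousOn
    hc.continuousOn
  have hM0 : 0 ≤ M := (norm_nonneg _).trans (hM x ⟨by linarith, by linarith⟩)
  refine ⟨M, hM0, fun h hh => ?_⟩
  rcases eq_or_ne h 0 with rfl | h0
  · exact ⟨0, by simpa using hM0, by simp⟩
  have hne : x ≠ x + h := by simpa using h0
  obtain ⟨y, hy, e⟩ := taylor_mean_remainder_lagrange_iteratedDeriv (n := 5) hne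
    ((contDiff_infty.1 hf 6).contDiffOn)
  have hy' : y ∈ Set.Icc (x - 3) (x + 3) := by
    have h1 := Set.uIoo_subset_uIcc_self hy
    rw [abs_le] at hh
    refine (Set.uIcc_subset_Icc ?_ ?_) h1 <;> constructor <;> linarith
  have hid : ∀ k : ℕ, iteratedDerivWithin k f (Set.uIcc x (x + h)) x = iteratedDeriv k f x :=
    fun k => iteratedDerivWithin_eq_iteratedDeriv (uniqueDiffOn_uIcc hne)
      ((contDiff_infty.1 hf k).contDiffAt) Set.left_mem_uIcc
  refine ⟨iteratedDeriv 6 f y / 720, ?_, ?_⟩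
  · have := hM y hy'
    rw [Real.norm_eq_abs] at this
    rw [abs_div, abs_of_pos (by norm_num : (0:ℝ) < 720)]
    linarith
  · simp only [taylor_within_apply, Finset.sum_range_succ, Finset.sum_range_zero, hid,
      add_sub_cancel_left, smul_eq_mul, Nat.factorial, iteratedDeriv_zero, iteratedDeriv_one] at e
    norm_num at e
    linarith

lemma aux_sq (p1 p2 p3 p4 p5 M : ℝ) : ∃ K : ℝ, 0 ≤ K ∧ ∀ h r : ℝ, 0 < h → h < 1 → |r| ≤ M →
    |(p1 * h + p2 * h ^ 2 + p3 * h ^ 3 + p4 * h ^ 4 + p5 * h ^ 5 + r * h ^ 6) ^ 2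
      - (p1 ^ 2 * h ^ 2 + 2 * p1 * p2 * h ^ 3 + (p2 ^ 2 + 2 * p1 * p3) * h ^ 4
        + (2 * p1 * p4 + 2 * p2 * p3) * h ^ 5
        + (2 * p1 * p5 + 2 * p2 * p4 + p3 ^ 2) * h ^ 6)| ≤ K * h ^ 7 := by
  let E : ℝ × ℝ → ℝ := fun z =>
    (2 * p1 * z.2 + 2 * p2 * p5 + 2 * p3 * p4) + (2 * p2 * z.2 + 2 * p3 * p5 + p4 ^ 2) * z.1
      + (2 * p3 * z.2 + 2 * p4 * p5) * z.1 ^ 2 + (2 * p4 * z.2 + p5 ^ 2) * z.1 ^ 3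
      + 2 * p5 * z.2 * z.1 ^ 4 + z.2 ^ 2 * z.1 ^ 5
  have hE : Continuous E := by fun_prop
  obtain ⟨K, hK⟩ := ((isCompact_Icc (a := (0:ℝ)) (b := 1)).prod
    (isCompact_Icc (a := -M) (b := M))).exists_bound_of_continuousOn hE.continuousOn
  refine ⟨max K 0, le_max_right _ _, fun h r h0 h1 hr => ?_⟩
  have hb := hK (h, r) ⟨⟨h0.le, h1.le⟩, abs_le.1 hr⟩
  rw [Real.norm_eq_abs] at hb
  have e : (p1 * h + p2 * h ^ 2 + p3 * h ^ 3 + p4 * h ^ 4 + p5 * h ^ 5 + r * h ^ 6) ^ 2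
      - (p1 ^ 2 * h ^ 2 + 2 * p1 * p2 * h ^ 3 + (p2 ^ 2 + 2 * p1 * p3) * h ^ 4
        + (2 * p1 * p4 + 2 * p2 * p3) * h ^ 5
        + (2 * p1 * p5 + 2 * p2 * p4 + p3 ^ 2) * h ^ 6) = E (h, r) * h ^ 7 := by
    simp only [E]; ring
  rw [e, abs_mul, abs_of_pos (pow_pos h0 7)]
  exact mul_le_mul_of_nonneg_right (hb.trans (le_max_left _ _)) (pow_pos h0 7).le

/-- Combination of five point values: bound for one indicator. -/
lemma aux_comb {A B C D K L h : ℝ} (h1 : |A - B| ≤ K * h) (h2 : |C - D| ≤ L * h) :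
    |(1 / 4) * A + (13 / 12) * C - ((1 / 4) * B + (13 / 12) * D)|
      ≤ ((1 / 4) * K + (13 / 12) * L) * h := by
  rw [abs_le] at *
  constructor <;> linarith [h1.1, h1.2, h2.1, h2.2]

/-- Taylor expansions of the left-boundary smoothness indicators
`β_k⁻(x,Δx) = β_k(x−Δx,Δx)` as `Δx → 0⁺` (derivatives evaluated at `x`). -/
theorem weno_beta_minus_taylor
    (f : ℝ → ℝ) (hf : ContDiff ℝ (⊤ : ℕ∞) f) (x : ℝ) :
    ∃ C > (0 : ℝ), ∃ δ > (0 : ℝ), ∀ Δx : ℝ, 0 < Δx → Δx < δ →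
      |wenoBeta f (x - Δx) Δx 0 -
        ((deriv f x) ^ 2 * Δx ^ 2
          - 2 * deriv f x * iteratedDeriv 2 f x * Δx ^ 3
          + ((25 / 12) * (iteratedDeriv 2 f x) ^ 2
              + (1 / 3) * deriv f x * iteratedDeriv 3 f x) * Δx ^ 4
          - ((14 / 3) * iteratedDeriv 2 f x * iteratedDeriv 3 f x
              - (5 / 6) * deriv f x * iteratedDeriv 4 f x) * Δx ^ 5
          + ((157 / 36) * (iteratedDeriv 3 f x) ^ 2
              + (265 / 72) * iteratedDeriv 2 f x * iteratedDeriv 4 f x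
              - (59 / 60) * deriv f x * iteratedDeriv 5 f x) * Δx ^ 6)| ≤ C * Δx ^ 7 ∧
      |wenoBeta f (x - Δx) Δx 1 -
        ((deriv f x) ^ 2 * Δx ^ 2
          - 2 * deriv f x * iteratedDeriv 2 f x * Δx ^ 3
          + ((25 / 12) * (iteratedDeriv 2 f x) ^ 2
              + (4 / 3) * deriv f x * iteratedDeriv 3 f x) * Δx ^ 4
          - ((7 / 2) * iteratedDeriv 2 f x * iteratedDeriv 3 f x
              + (2 / 3) * deriv f x * iteratedDeriv 4 f x) * Δx ^ 5
          + ((55 / 36) * (iteratedDeriv 3 f x) ^ 2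
              + (139 / 72) * iteratedDeriv 2 f x * iteratedDeriv 4 f x
              + (4 / 15) * deriv f x * iteratedDeriv 5 f x) * Δx ^ 6)| ≤ C * Δx ^ 7 ∧
      |wenoBeta f (x - Δx) Δx 2 -
        ((deriv f x) ^ 2 * Δx ^ 2
          - 2 * deriv f x * iteratedDeriv 2 f x * Δx ^ 3
          + ((25 / 12) * (iteratedDeriv 2 f x) ^ 2
              + (1 / 3) * deriv f x * iteratedDeriv 3 f x) * Δx ^ 4
          - ((1 / 3) * iteratedDeriv 2 f x * iteratedDeriv 3 f x
              + (1 / 6) * deriv f x * iteratedDeriv 4 f x) * Δx ^ 5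
          + ((1 / 36) * (iteratedDeriv 3 f x) ^ 2
              + (25 / 72) * iteratedDeriv 2 f x * iteratedDeriv 4 f x
              + (1 / 60) * deriv f x * iteratedDeriv 5 f x) * Δx ^ 6)| ≤ C * Δx ^ 7 := by
  obtain ⟨M, hM0, hM⟩ := aux_taylor f hf x
  generalize deriv f x = a at *
  generalize iteratedDeriv 2 f x = b at *
  generalize iteratedDeriv 3 f x = c at *
  generalize iteratedDeriv 4 f x = d at *
  generalize iteratedDeriv 5 f x = e at *
  obtain ⟨KP0, hKP0, HP0⟩ := aux_sq ((2 / 1 : ℝ) * a) ((-2 / 1 : ℝ) * b) ((1 / 3 : ℝ) * c) ((5 / 6 : ℝ) * d) ((-59 / 60 : ℝ) * e) (4000 * M)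
  obtain ⟨KQ0, hKQ0, HQ0⟩ := aux_sq ((0 / 1 : ℝ) * a) ((1 / 1 : ℝ) * b) ((-2 / 1 : ℝ) * c) ((25 / 12 : ℝ) * d) ((-3 / 2 : ℝ) * e) (4000 * M)
  obtain ⟨KP1, hKP1, HP1⟩ := aux_sq ((2 / 1 : ℝ) * a) ((-2 / 1 : ℝ) * b) ((4 / 3 : ℝ) * c) ((-2 / 3 : ℝ) * d) ((4 / 15 : ℝ) * e) (4000 * M)
  obtain ⟨KQ1, hKQ1, HQ1⟩ := aux_sq ((0 / 1 : ℝ) * a) ((1 / 1 : ℝ) * b) ((-1 / 1 : ℝ) * c) ((7 / 12 : ℝ) * d) ((-1 / 4 : ℝ) * e) (4000 * M)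
  obtain ⟨KP2, hKP2, HP2⟩ := aux_sq ((-2 / 1 : ℝ) * a) ((2 / 1 : ℝ) * b) ((-1 / 3 : ℝ) * c) ((1 / 6 : ℝ) * d) ((-1 / 60 : ℝ) * e) (4000 * M)
  obtain ⟨KQ2, hKQ2, HQ2⟩ := aux_sq ((0 / 1 : ℝ) * a) ((1 / 1 : ℝ) * b) ((0 / 1 : ℝ) * c) ((1 / 12 : ℝ) * d) ((0 / 1 : ℝ) * e) (4000 * M)
  refine ⟨((1 / 4) * KP0 + (13 / 12) * KQ0) + ((1 / 4) * KP1 + (13 / 12) * KQ1) + ((1 / 4) * KP2 + (13 / 12) * KQ2) + 1, by positivity, 1, one_pos, fun h h0 h1 => ?_⟩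
  obtain ⟨r3, hr3, er3⟩ := hM ((-3) * h) (by rw [abs_le]; constructor <;> linarith)
  obtain ⟨r2, hr2, er2⟩ := hM ((-2) * h) (by rw [abs_le]; constructor <;> linarith)
  obtain ⟨r1, hr1, er1⟩ := hM ((-1) * h) (by rw [abs_le]; constructor <;> linarith)
  obtain ⟨q1, hq1, eq1⟩ := hM ((1) * h) (by rw [abs_le]; constructor <;> linarith)
  rw [abs_le] at hr3
  rw [abs_le] at hr2
  rw [abs_le] at hr1
  rw [abs_le] at hq1
  have f3 : x - h - 2 * h = x + (-3) * h := by ring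
  have f2 : x - h - h = x + (-2) * h := by ring
  have f1 : x - h = x + (-1) * h := by ring
  have f0 : x - h + h = x := by ring
  have g1 : x - h + 2 * h = x + 1 * h := by ring
  have hp : 0 < h ^ 7 := pow_pos h0 7
  refine ⟨?_, ?_, ?_⟩
  · have G := aux_comb (HP0 h ((729) * r3 + (-256) * r2 + (3) * r1) h0 h1 (by rw [abs_le]; constructor <;> linarith))
      (HQ0 h ((729) * r3 + (-128) * r2 + (1) * r1) h0 h1 (by rw [abs_le]; constructor <;> linarith))
    refine le_trans (le_of_eq ?_) (G.trans (mul_le_mul_of_nonneg_right (by linarith) hp.le))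
    congr 1
    simp only [wenoBeta]
    rw [f3, f2, f1, er3, er2, er1]
    ring
  · have G := aux_comb (HP1 h ((-64) * r2) h0 h1 (by rw [abs_le]; constructor <;> linarith))
      (HQ1 h ((64) * r2 + (-2) * r1) h0 h1 (by rw [abs_le]; constructor <;> linarith))
    refine le_trans (le_of_eq ?_) (G.trans (mul_le_mul_of_nonneg_right (by linarith) hp.le))
    congr 1
    simp only [wenoBeta]
    rw [f0, f2, f1, er2, er1]
    ring
  · have G := aux_comb (HP2 h ((3) * r1 + (1) * q1) h0 h1 (by rw [abs_le]; constructor <;> linarith))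
      (HQ2 h ((1) * r1 + (1) * q1) h0 h1 (by rw [abs_le]; constructor <;> linarith))
    refine le_trans (le_of_eq ?_) (G.trans (mul_le_mul_of_nonneg_right (by linarith) hp.le))
    congr 1
    simp only [wenoBeta]
    rw [f0, g1, f1, er1, eq1]
    ring
end

section
/- Let f : ℝ → ℝ be infinitely differentiable and let x ∈ ℝ. Then, as Δx → 0⁺ (all derivatives evaluated at x): β₂⁺(x,Δx) − β₀⁺(x,Δx) = ((13/3)f″f‴ − f′f⁽⁴⁾)Δx⁵ + ((103/36)f‴f⁽⁴⁾ + (13/12)f″f⁽⁵⁾ − (1/6)f′f⁽⁶⁾)Δx⁷ + O(Δx⁹); in particular all even powers of Δx cancel in the difference, and τ⁺(x,Δx) = |β₂⁺(x,Δx) − β₀⁺(x,Δx)| = O(Δx⁵). -/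
theorem weno_aux_taylor (f : ℝ → ℝ) (hf : ContDiff ℝ (⊤ : ℕ∞) f) (x : ℝ) :
    ∃ M > (0 : ℝ), ∃ δ > (0 : ℝ), ∀ t : ℝ, |t| < δ → ∃ g : ℝ, |g| ≤ M ∧
      f (x + t) = f x + deriv f x * t + iteratedDeriv 2 f x / 2 * t ^ 2
        + iteratedDeriv 3 f x / 6 * t ^ 3 + iteratedDeriv 4 f x / 24 * t ^ 4
        + iteratedDeriv 5 f x / 120 * t ^ 5 + iteratedDeriv 6 f x / 720 * t ^ 6
        + iteratedDeriv 7 f x / 5040 * t ^ 7 + t ^ 8 * g := by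
  have h8 : ContDiff ℝ (8 : ℕ) f := contDiff_infty.1 hf 8
  have h := (taylor_isLittleO_univ (x₀ := x) h8).def (c := 1) one_pos
  rw [Metric.eventually_nhds_iff] at h
  obtain ⟨δ, hδ, h⟩ := h
  refine ⟨1 + |iteratedDeriv 8 f x / 40320|, by positivity, δ, hδ, fun t ht => ?_⟩
  have h1 := h (y := x + t) (by simpa [Real.dist_eq] using ht)
  simp only [taylor_within_apply, Finset.sum_range_succ, Finset.sum_range_zero,
    iteratedDerivWithin_univ, iteratedDeriv_zero, iteratedDeriv_one, Nat.factorial,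
    add_sub_cancel_left, smul_eq_mul, Real.norm_eq_abs, one_mul, abs_pow] at h1
  norm_num at h1
  rcases eq_or_ne t 0 with rfl | h0
  · exact ⟨0, by simp; positivity, by simp⟩
  have ht8 : (0 : ℝ) < |t| ^ 8 := by positivity
  set R := f (x + t) - (f x + deriv f x * t + iteratedDeriv 2 f x / 2 * t ^ 2
        + iteratedDeriv 3 f x / 6 * t ^ 3 + iteratedDeriv 4 f x / 24 * t ^ 4
        + iteratedDeriv 5 f x / 120 * t ^ 5 + iteratedDeriv 6 f x / 720 * t ^ 6
        + iteratedDeriv 7 f x / 5040 * t ^ 7 + iteratedDeriv 8 f x / 40320 * t ^ 8) with hR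
  have h2 : |R| ≤ |t| ^ 8 := by
    rw [hR]
    convert h1 using 2 <;> try ring
  refine ⟨R / t ^ 8 + iteratedDeriv 8 f x / 40320, ?_, ?_⟩
  · refine (abs_add_le _ _).trans ?_
    gcongr
    rw [abs_div, abs_pow]
    exact (div_le_one ht8).2 h2
  · have : t ^ 8 * (R / t ^ 8 + iteratedDeriv 8 f x / 40320)
        = R + iteratedDeriv 8 f x / 40320 * t ^ 8 := by field_simp
    rw [this, hR]; ring

/-- The remainder polynomial. -/
noncomputable def wenoRem (a1 a2 a3 a4 a5 a6 a7 h u v w z : ℝ) : ℝ :=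
  let G := 256 * v - 4 * u
  let H := 256 * z - 4 * w
  let K := 256 * v - 2 * u
  let L := 256 * z - 2 * w
  let p := -2 * a1 + 4 * a3 * h ^ 2 + 28 * a5 * h ^ 4 + 124 * a7 * h ^ 6
  let q := 12 * a4 + 60 * a6 * h ^ 2
  let r := 6 * a3 + 30 * a5 * h ^ 2 + 126 * a7 * h ^ 4
  let s := 2 * a2 + 14 * a4 * h ^ 2 + 62 * a6 * h ^ 4
  (1 / 4) * (2 * p * (G + H) + h ^ 3 * (G - H) * (2 * q) + h ^ 7 * (G - H) * (G + H)
      + 4 * (4 * a3 * 60 * a6 + 28 * a5 * q + 124 * a7 * h ^ 2 * q))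
  + (13 / 12) * (2 * r * h ^ 2 * (K + L) + 2 * s * h * (K - L) + h ^ 7 * (K - L) * (K + L)
      + 4 * (6 * a3 * 62 * a6 + 30 * a5 * (14 * a4 + 62 * a6 * h ^ 2) + 126 * a7 * s))

set_option maxRecDepth 10000 in
set_option maxHeartbeats 1000000 in
theorem wenoRem_cont {X : Type} [TopologicalSpace X] (a1 a2 a3 a4 a5 a6 a7 : ℝ)
    {h u v w z : X → ℝ} (hh : Continuous h) (hu : Continuous u) (hv : Continuous v)
    (hw : Continuous w) (hz : Continuous z) :
    Continuous fun y => wenoRem a1 a2 a3 a4 a5 a6 a7 (h y) (u y) (v y) (w y) (z y) := by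
  simp only [wenoRem]
  fun_prop

theorem wenoRem_bound (a1 a2 a3 a4 a5 a6 a7 M : ℝ) :
    ∃ C, ∀ h u v w z : ℝ, |h| ≤ 1 → |u| ≤ M → |v| ≤ M → |w| ≤ M → |z| ≤ M →
      |wenoRem a1 a2 a3 a4 a5 a6 a7 h u v w z| ≤ C := by
  have hc : IsCompact (Set.Icc (-1 : ℝ) 1 ×ˢ Set.Icc (-M) M ×ˢ Set.Icc (-M) M ×ˢ
      Set.Icc (-M) M ×ˢ Set.Icc (-M) M) :=
    isCompact_Icc.prod (isCompact_Icc.prod (isCompact_Icc.prod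
      (isCompact_Icc.prod isCompact_Icc)))
  obtain ⟨C, hC⟩ := hc.exists_bound_of_continuousOn
    (f := fun y : ℝ × ℝ × ℝ × ℝ × ℝ =>
      wenoRem a1 a2 a3 a4 a5 a6 a7 y.1 y.2.1 y.2.2.1 y.2.2.2.1 y.2.2.2.2)
    (by exact (wenoRem_cont a1 a2 a3 a4 a5 a6 a7 (by fun_prop) (by fun_prop) (by fun_prop)
      (by fun_prop) (by fun_prop)).continuousOn)
  refine ⟨C, fun h u v w z hh hu hv hw hz => ?_⟩
  exact hC (h, u, v, w, z) ⟨abs_le.1 hh, abs_le.1 hu, abs_le.1 hv, abs_le.1 hw, abs_le.1 hz⟩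

/-- Taylor expansion of `β₂⁺ − β₀⁺` (all even powers of `Δx` cancel),
and the global smoothness indicator satisfies `τ⁺ = |β₂⁺ − β₀⁺| = O(Δx⁵)`. -/
theorem weno_tau_plus_taylor
    (f : ℝ → ℝ) (hf : ContDiff ℝ (⊤ : ℕ∞) f) (x : ℝ) :
    ∃ C > (0 : ℝ), ∃ δ > (0 : ℝ), ∀ Δx : ℝ, 0 < Δx → Δx < δ →
      |(wenoBeta f x Δx 2 - wenoBeta f x Δx 0) -
        (((13 / 3) * iteratedDeriv 2 f x * iteratedDeriv 3 f x
            - deriv f x * iteratedDeriv 4 f x) * Δx ^ 5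
          + ((103 / 36) * iteratedDeriv 3 f x * iteratedDeriv 4 f x
              + (13 / 12) * iteratedDeriv 2 f x * iteratedDeriv 5 f x
              - (1 / 6) * deriv f x * iteratedDeriv 6 f x) * Δx ^ 7)| ≤ C * Δx ^ 9 ∧
      |wenoBeta f x Δx 2 - wenoBeta f x Δx 0| ≤ C * Δx ^ 5 := by
  obtain ⟨M, hM, δ, hδ, hT⟩ := weno_aux_taylor f hf x
  obtain ⟨C, hC⟩ := wenoRem_bound (deriv f x) (iteratedDeriv 2 f x / 2) (iteratedDeriv 3 f x / 6)
    (iteratedDeriv 4 f x / 24) (iteratedDeriv 5 f x / 120) (iteratedDeriv 6 f x / 720)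
    (iteratedDeriv 7 f x / 5040) M
  set P := (13 / 3) * iteratedDeriv 2 f x * iteratedDeriv 3 f x
            - deriv f x * iteratedDeriv 4 f x with hP
  set Q := (103 / 36) * iteratedDeriv 3 f x * iteratedDeriv 4 f x
              + (13 / 12) * iteratedDeriv 2 f x * iteratedDeriv 5 f x
              - (1 / 6) * deriv f x * iteratedDeriv 6 f x with hQ
  refine ⟨|C| + |P| + |Q| + 1, by positivity, min 1 (δ / 2), by positivity, fun h h0 h1 => ?_⟩
  have hl1 : h < 1 := h1.trans_le (min_le_left _ _)
  have hl2 : h < δ / 2 := h1.trans_le (min_le_right _ _)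
  obtain ⟨u, hu, eu⟩ := hT h (by rw [abs_lt]; constructor <;> linarith)
  obtain ⟨v, hv, ev⟩ := hT (2 * h) (by rw [abs_lt]; constructor <;> linarith)
  obtain ⟨w, hw, ew⟩ := hT (-h) (by rw [abs_lt]; constructor <;> linarith)
  obtain ⟨z, hz, ez⟩ := hT (-(2 * h)) (by rw [abs_lt]; constructor <;> linarith)
  rw [← sub_eq_add_neg] at ew ez
  have hb := hC h u v w z (by rw [abs_le]; constructor <;> linarith) hu hv hw hz
  set W := wenoRem (deriv f x) (iteratedDeriv 2 f x / 2) (iteratedDeriv 3 f x / 6)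
    (iteratedDeriv 4 f x / 24) (iteratedDeriv 5 f x / 120) (iteratedDeriv 6 f x / 720)
    (iteratedDeriv 7 f x / 5040) h u v w z with hW
  have key : wenoBeta f x h 2 - wenoBeta f x h 0 = P * h ^ 5 + Q * h ^ 7 + h ^ 9 * W := by
    simp only [wenoBeta, eu, ev, ew, ez, hW, wenoRem, hP, hQ]
    ring
  have hWC : |W| ≤ |C| := hb.trans (le_abs_self C)
  have p5 : 0 < h ^ 5 := by positivity
  have p9 : 0 < h ^ 9 := by positivity
  have h75 : h ^ 7 ≤ h ^ 5 := pow_le_pow_of_le_one h0.le hl1.le (by norm_num)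
  have h95 : h ^ 9 ≤ h ^ 5 := pow_le_pow_of_le_one h0.le hl1.le (by norm_num)
  rw [key]
  constructor
  · rw [add_sub_cancel_left, abs_mul, abs_of_pos p9, mul_comm]
    gcongr
    linarith [abs_nonneg P, abs_nonneg Q]
  · calc |P * h ^ 5 + Q * h ^ 7 + h ^ 9 * W|
        ≤ |P * h ^ 5| + |Q * h ^ 7| + |h ^ 9 * W| := abs_add_three _ _ _
      _ = |P| * h ^ 5 + |Q| * h ^ 7 + |W| * h ^ 9 := by
          rw [abs_mul, abs_mul, abs_mul, abs_of_pos p5, abs_of_pos p9,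
            abs_of_pos (pow_pos h0 7), mul_comm (h ^ 9)]
      _ ≤ |P| * h ^ 5 + |Q| * h ^ 5 + |C| * h ^ 5 := by gcongr
      _ ≤ (|C| + |P| + |Q| + 1) * h ^ 5 := by nlinarith
end

section
/- (Sufficiency of Condition 1 for fifth-order accuracy.) Let f : ℝ → ℝ be infinitely differentiable, let x ∈ ℝ, and let ω_k^+ , ω_k^− : (0,∞) → ℝ (k = 0,1,2) be weight functions of Δx satisfying, for each sign, Σ_{k=0}^{2} ω_k^±(Δx) = 1 for all Δx, and ω_k^±(Δx) = d_k + O(Δx³) as Δx → 0⁺ for each k. Then the WENO flux difference satisfies (1/Δx)·[Σ_{k=0}^{2} ω_k^+(Δx)·f̂^k(x,Δx) − Σ_{k=0}^{2} ω_k^−(Δx)·f̂^{k,−}(x,Δx)] = f′(x) + O(Δx⁵) as Δx → 0⁺. -/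
/-- The ideal weights `(d₀, d₁, d₂) = (1/10, 6/10, 3/10)`. -/
noncomputable def wenoD : Fin 3 → ℝ
  | 0 => 1 / 10
  | 1 => 6 / 10
  | 2 => 3 / 10

open Asymptotics Filter Topology in
theorem weno_taylor (f : ℝ → ℝ) (hf : ContDiff ℝ (⊤ : ℕ∞) f) (x : ℝ) :
    ∃ (a0 a2 a3 a4 a5 : ℝ) (r : ℝ → ℝ), (r =O[𝓝 0] fun t => t ^ 6) ∧
      ∀ t, f (x + t) = a0 + deriv f x * t + a2 * t ^ 2 + a3 * t ^ 3 + a4 * t ^ 4 + a5 * t ^ 5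
        + r t := by
  have h6 : ContDiff ℝ ((6 : ℕ) : WithTop ℕ∞) f := contDiff_infty.1 hf 6
  have h := taylor_isLittleO_univ (x₀ := x) h6
  have ht : Tendsto (fun t : ℝ => x + t) (𝓝 0) (𝓝 x) := by
    have : Continuous (fun t : ℝ => x + t) := by fun_prop
    simpa using this.tendsto 0
  have h2 := (h.comp_tendsto ht).isBigO
  have h3 : (fun t : ℝ => iteratedDeriv 6 f x / 720 * t ^ 6) =O[𝓝 0] fun t => t ^ 6 :=
    (isBigO_refl _ _).const_mul_left _
  refine ⟨f x, iteratedDeriv 2 f x / 2, iteratedDeriv 3 f x / 6, iteratedDeriv 4 f x / 24,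
    iteratedDeriv 5 f x / 120, fun t => f (x + t) - (f x + deriv f x * t
      + iteratedDeriv 2 f x / 2 * t ^ 2 + iteratedDeriv 3 f x / 6 * t ^ 3
      + iteratedDeriv 4 f x / 24 * t ^ 4 + iteratedDeriv 5 f x / 120 * t ^ 5), ?_, ?_⟩
  · refine ((h2.congr_right (g₂ := fun t => t ^ 6) ?_).add h3).congr_left ?_
    · intro t; simp
    · intro t
      simp only [Function.comp, taylor_within_apply, Finset.sum_range_succ, Finset.sum_range_zero,
        iteratedDerivWithin_univ, iteratedDeriv_zero, iteratedDeriv_one, Nat.factorial, smul_eq_mul,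
        add_sub_cancel_left]
      push_cast
      ring
  · intro t; ring

open Asymptotics Filter Topology in
theorem weno_bigO_iff (g : ℝ → ℝ) (n : ℕ) :
    (g =O[𝓝[>] 0] fun h => h ^ n) ↔
    ∃ C > (0 : ℝ), ∃ δ > (0 : ℝ), ∀ h : ℝ, 0 < h → h < δ → |g h| ≤ C * h ^ n := by
  constructor
  · intro H
    obtain ⟨C, hC, H⟩ := H.exists_pos
    rw [IsBigOWith, Filter.Eventually, mem_nhdsGT_iff_exists_Ioo_subset] at H
    obtain ⟨δ, hδ, H⟩ := H
    refine ⟨C, hC, δ, hδ, fun h h0 h1 => ?_⟩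
    have := H ⟨h0, h1⟩
    simpa [abs_of_pos h0] using this
  · rintro ⟨C, hC, δ, hδ, H⟩
    refine IsBigO.of_bound C ?_
    filter_upwards [Ioo_mem_nhdsGT hδ] with h hh
    have := H h hh.1 hh.2
    simpa [abs_of_pos hh.1] using this

open Asymptotics Filter Topology in
theorem weno_third (f : ℝ → ℝ) (hf : ContDiff ℝ (⊤ : ℕ∞) f) (x j : ℝ) :
    (fun h : ℝ => -f (x + j * h) + 3 * f (x + (j + 1) * h) - 3 * f (x + (j + 2) * h)
      + f (x + (j + 3) * h)) =O[𝓝[>] 0] fun h => h ^ 3 := by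
  obtain ⟨a0, a2, a3, a4, a5, r, hr, hf⟩ := weno_taylor f hf x
  have hrj : ∀ c : ℝ, (fun h => r (c * h)) =O[𝓝[>] 0] fun h : ℝ => h ^ 3 := by
    intro c
    have ht : Tendsto (fun t : ℝ => c * t) (𝓝[>] 0) (𝓝 0) := by
      have : Continuous (fun t : ℝ => c * t) := by fun_prop
      simpa using (this.tendsto 0).mono_left nhdsWithin_le_nhds
    refine (hr.comp_tendsto ht).trans ?_
    have h1 : (fun h : ℝ => c ^ 6 * h ^ 3) =O[𝓝[>] 0] fun _ => (1 : ℝ) := by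
      have : Continuous (fun h : ℝ => c ^ 6 * h ^ 3) := by fun_prop
      exact ((this.tendsto 0).mono_left nhdsWithin_le_nhds).isBigO_one ℝ
    refine (h1.mul (isBigO_refl (fun h : ℝ => h ^ 3) _)).congr ?_ ?_
    · intro h; simp only [Function.comp]; ring
    · intro h; ring
  let q : ℝ → ℝ := fun h => a3 * (-j ^ 3 + 3 * (j + 1) ^ 3 - 3 * (j + 2) ^ 3 + (j + 3) ^ 3)
    + a4 * (-j ^ 4 + 3 * (j + 1) ^ 4 - 3 * (j + 2) ^ 4 + (j + 3) ^ 4) * h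
    + a5 * (-j ^ 5 + 3 * (j + 1) ^ 5 - 3 * (j + 2) ^ 5 + (j + 3) ^ 5) * h ^ 2
  have hq : q =O[𝓝[>] 0] fun _ => (1 : ℝ) := by
    have : Continuous q := by fun_prop
    exact ((this.tendsto 0).mono_left nhdsWithin_le_nhds).isBigO_one ℝ
  have hq3 : (fun h => q h * h ^ 3) =O[𝓝[>] 0] fun h : ℝ => h ^ 3 := by
    simpa using hq.mul (isBigO_refl (fun h : ℝ => h ^ 3) _)
  refine ((((hq3.sub (hrj j)).add ((hrj (j + 1)).const_mul_left 3)).sub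
    ((hrj (j + 2)).const_mul_left 3)).add (hrj (j + 3))).congr_left ?_
  intro h
  simp only [hf, q]
  ring

open Asymptotics Filter Topology in
theorem weno_linear (f : ℝ → ℝ) (hf : ContDiff ℝ (⊤ : ℕ∞) f) (x : ℝ) :
    (fun h : ℝ => (-2 * f (x + (-3) * h) + 15 * f (x + (-2) * h) - 60 * f (x + (-1) * h)
      + 20 * f (x + 0 * h) + 30 * f (x + 1 * h) - 3 * f (x + 2 * h)) / 60 - h * deriv f x)
      =O[𝓝[>] 0] fun h => h ^ 6 := by
  obtain ⟨a0, a2, a3, a4, a5, r, hr, hf⟩ := weno_taylor f hf x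
  have hrj : ∀ c d : ℝ, (fun h => d * r (c * h)) =O[𝓝[>] 0] fun h : ℝ => h ^ 6 := by
    intro c d
    have ht : Tendsto (fun t : ℝ => c * t) (𝓝[>] 0) (𝓝 0) := by
      have : Continuous (fun t : ℝ => c * t) := by fun_prop
      simpa using (this.tendsto 0).mono_left nhdsWithin_le_nhds
    refine ((hr.comp_tendsto ht).trans ?_).const_mul_left d
    refine ((isBigO_refl (fun h : ℝ => h ^ 6) _).const_mul_left (c ^ 6)).congr_left ?_
    intro h; simp only [Function.comp]; ring
  refine ((((((hrj (-3) (-2 / 60)).add (hrj (-2) (15 / 60))).add (hrj (-1) (-60 / 60))).add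
    (hrj 0 (20 / 60))).add (hrj 1 (30 / 60))).add (hrj 2 (-3 / 60))).congr_left ?_
  intro h
  simp only [hf]
  ring

/-- sufficiency of Condition 1 for fifth-order accuracy:
if the weights sum to 1 and satisfy `ω_k^± = d_k + O(Δx³)`, then the WENO flux
difference equals `f′(x) + O(Δx⁵)` as `Δx → 0⁺`. -/
theorem weno_condition1_sufficient
    (f : ℝ → ℝ) (hf : ContDiff ℝ (⊤ : ℕ∞) f) (x : ℝ)
    (ωp ωm : Fin 3 → ℝ → ℝ)
    (hsum_p : ∀ Δx : ℝ, 0 < Δx → ∑ k : Fin 3, ωp k Δx = 1)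
    (hsum_m : ∀ Δx : ℝ, 0 < Δx → ∑ k : Fin 3, ωm k Δx = 1)
    (hO_p : ∀ k : Fin 3, ∃ C > (0 : ℝ), ∃ δ > (0 : ℝ), ∀ Δx : ℝ, 0 < Δx → Δx < δ →
      |ωp k Δx - wenoD k| ≤ C * Δx ^ 3)
    (hO_m : ∀ k : Fin 3, ∃ C > (0 : ℝ), ∃ δ > (0 : ℝ), ∀ Δx : ℝ, 0 < Δx → Δx < δ →
      |ωm k Δx - wenoD k| ≤ C * Δx ^ 3) :
    ∃ C > (0 : ℝ), ∃ δ > (0 : ℝ), ∀ Δx : ℝ, 0 < Δx → Δx < δ →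
      |(1 / Δx) * (∑ k : Fin 3, ωp k Δx * wenoFhat f x Δx k
          - ∑ k : Fin 3, ωm k Δx * wenoFhat f (x - Δx) Δx k)
        - deriv f x| ≤ C * Δx ^ 5 := by
  have hp := fun k => (weno_bigO_iff (fun h => ωp k h - wenoD k) 3).2 (hO_p k)
  have hm := fun k => (weno_bigO_iff (fun h => ωm k h - wenoD k) 3).2 (hO_m k)
  refine (weno_bigO_iff (fun Δx => (1 / Δx) * (∑ k : Fin 3, ωp k Δx * wenoFhat f x Δx k
          - ∑ k : Fin 3, ωm k Δx * wenoFhat f (x - Δx) Δx k) - deriv f x) 5).1 ?_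
  have D := weno_third f hf x
  have L := weno_linear f hf x
  have A0 := ((D (-1)).sub ((D (-2)).const_mul_left 2)).const_mul_left (1 / 6)
  have A1 := (D (-1)).const_mul_left (1 / 6)
  have B0 := ((D (-2)).sub ((D (-3)).const_mul_left 2)).const_mul_left (1 / 6)
  have B1 := (D (-2)).const_mul_left (1 / 6)
  have M := (((((hp 0).mul A0).add ((hp 1).mul A1)).sub ((hm 0).mul B0)).sub
    ((hm 1).mul B1)).add (L.congr_right (fun h => by ring))
  have N := (Asymptotics.isBigO_refl (fun h : ℝ => 1 / h) (nhdsWithin 0 (Set.Ioi 0))).mul M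
  refine N.congr' ?_ ?_
  · filter_upwards [self_mem_nhdsWithin] with h hh
    have hh : 0 < h := hh
    have sp := hsum_p h hh
    have sm := hsum_m h hh
    rw [Fin.sum_univ_three] at sp sm
    have ep : ωp 2 h = 1 - ωp 0 h - ωp 1 h := by linarith
    have em : ωm 2 h = 1 - ωm 0 h - ωm 1 h := by linarith
    simp only [Fin.sum_univ_three, ep, em, wenoFhat, wenoD]
    have e1 : x - h - 2 * h = x + (-3) * h := by ring
    have e2 : x - h - h = x + (-2) * h := by ring
    have e2' : x - 2 * h = x + (-2) * h := by ring
    have e3 : x - h + h = x + 0 * h := by ring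
    have e4 : x - h + 2 * h = x + 1 * h := by ring
    have e5 : x - h = x + (-1) * h := by ring
    have e6 : f x = f (x + 0 * h) := by simp
    have e7 : x + h = x + 1 * h := by ring
    rw [e1, e2, e2', e3, e4, e5, e6, e7]
    norm_num
    field_simp
    ring
  · filter_upwards [self_mem_nhdsWithin] with h hh
    have hh : h ≠ 0 := ne_of_gt hh
    field_simp
end

section
/- Let f : ℝ → ℝ be infinitely differentiable and let x ∈ ℝ be a critical point of order 1, i.e. f′(x) = 0 and f″(x) ≠ 0. Then lim_{Δx → 0⁺} τ⁺(x,Δx)/((τ⁺(x,Δx) + β̄⁺(x,Δx))·Δx) = 4·|f‴(x)/f″(x)| and lim_{Δx → 0⁺} τ⁻(x,Δx)/((τ⁻(x,Δx) + β̄⁻(x,Δx))·Δx) = (52/25)·|f‴(x)/f″(x)|; in particular the WENO-ZC accelerating factor satisfies τ^±/(τ^± + β̄^±) = O(Δx) as Δx → 0⁺ at first-order critical points. -/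
open Filter Topology

/-- The global smoothness indicator `τ(x,Δx) = |β₂(x,Δx) − β₀(x,Δx)|`. -/
noncomputable def wenoTau (f : ℝ → ℝ) (x Δx : ℝ) : ℝ :=
  |wenoBeta f x Δx 2 - wenoBeta f x Δx 0|

/-- The mean smoothness indicator `β̄(x,Δx) = (β₀ + β₁ + β₂)/3`. -/
noncomputable def wenoBetaBar (f : ℝ → ℝ) (x Δx : ℝ) : ℝ :=
  (wenoBeta f x Δx 0 + wenoBeta f x Δx 1 + wenoBeta f x Δx 2) / 3

lemma weno_taylor_s13 (f : ℝ → ℝ) (hf : ContDiff ℝ (⊤ : ℕ∞) f) (x : ℝ) (h1 : deriv f x = 0) :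
    ∃ s : ℝ → ℝ, ContinuousAt s 0 ∧ s 0 = iteratedDeriv 3 f x / 6 ∧
      ∀ h, f (x + h) = f x + h ^ 2 * (iteratedDeriv 2 f x / 2 + h * s h) := by
  have hT := taylor_isLittleO_univ (f := f) (x₀ := x) (n := 3) (hf.of_le (by
    norm_cast))
  have hE : ∀ y, taylorWithinEval f 3 Set.univ x y = f x
      + (y - x) ^ 2 * (iteratedDeriv 2 f x / 2) + (y - x) ^ 3 * (iteratedDeriv 3 f x / 6) := by
    intro y
    simp only [taylorWithinEval_succ, taylor_within_zero_eval, iteratedDerivWithin_univ,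
      iteratedDeriv_one, h1, smul_eq_mul, zero_add]
    norm_num [Nat.factorial]
    ring
  have hT2 := hT.tendsto_div_nhds_zero
  have hadd : Tendsto (fun h : ℝ => x + h) (𝓝 0) (𝓝 x) := by
    have : ContinuousAt (fun h : ℝ => x + h) 0 := by fun_prop
    simpa [ContinuousAt] using this
  have hT3 := (hT2.comp hadd).add_const (iteratedDeriv 3 f x / 6)
  rw [zero_add] at hT3
  refine ⟨Function.update (fun h => (f (x + h) - f x - h ^ 2 * (iteratedDeriv 2 f x / 2)) / h ^ 3)
    0 (iteratedDeriv 3 f x / 6), ?_, by simp, ?_⟩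
  · rw [continuousAt_update_same]
    refine (hT3.mono_left nhdsWithin_le_nhds).congr' ?_
    filter_upwards [self_mem_nhdsWithin] with h hh
    have hh : h ≠ 0 := hh
    simp only [Function.comp, hE, add_sub_cancel_left]
    field_simp
    ring
  · intro h
    by_cases hh : h = 0
    · subst hh; simp
    · rw [Function.update_of_ne hh]
      field_simp
      ring

lemma weno_limit (T B P Q : ℝ → ℝ) (hP : ContinuousAt P 0) (hQ : ContinuousAt Q 0)
    (hQ0 : Q 0 ≠ 0) (hT : ∀ h, T h = |h ^ 5 * P h|) (hB : ∀ h, B h = h ^ 4 * Q h) :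
    Tendsto (fun h => T h / ((T h + B h) * h)) (𝓝[>] 0) (𝓝 (|P 0| / Q 0)) := by
  have hc : ContinuousAt (fun h => |P h| / (h * |P h| + Q h)) 0 := by
    refine ContinuousAt.div (by fun_prop) (by fun_prop) (by simpa using hQ0)
  have ht := hc.tendsto
  simp only [zero_mul, zero_add] at ht
  refine (ht.mono_left nhdsWithin_le_nhds).congr' ?_
  filter_upwards [self_mem_nhdsWithin] with h hh
  have hh : 0 < h := hh
  rw [hT, hB, abs_mul, abs_of_pos (pow_pos hh 5),
    show (h ^ 5 * |P h| + h ^ 4 * Q h) * h = h ^ 5 * (h * |P h| + Q h) by ring,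
    mul_div_mul_left _ _ (pow_pos hh 5).ne']

lemma weno_bound (T B : ℝ → ℝ) (L : ℝ)
    (h : Tendsto (fun h => T h / ((T h + B h) * h)) (𝓝[>] 0) (𝓝 L)) :
    ∀ᶠ h in 𝓝[>] (0 : ℝ), |T h / (T h + B h)| ≤ (|L| + 1) * h := by
  filter_upwards [h.abs.eventually_lt_const (lt_add_one |L|), self_mem_nhdsWithin] with h hh h0
  have h0 : 0 < h := h0
  rw [← div_div, abs_div, abs_of_pos h0, div_lt_iff₀ h0] at hh
  exact hh.le

/-- at a first-order critical point (`f′(x) = 0`, `f″(x) ≠ 0`),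
`τ⁺/((τ⁺ + β̄⁺)·Δx) → 4|f‴/f″|` and `τ⁻/((τ⁻ + β̄⁻)·Δx) → (52/25)|f‴/f″|`
as `Δx → 0⁺`; in particular the accelerating factor `τ^±/(τ^± + β̄^±)` is `O(Δx)`. -/
theorem weno_zc_accelerator_first_order_critical_point
    (f : ℝ → ℝ) (hf : ContDiff ℝ (⊤ : ℕ∞) f) (x : ℝ)
    (h1 : deriv f x = 0) (h2 : iteratedDeriv 2 f x ≠ 0) :
    Tendsto (fun Δx : ℝ =>
        wenoTau f x Δx / ((wenoTau f x Δx + wenoBetaBar f x Δx) * Δx))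
      (𝓝[>] 0)
      (𝓝 (4 * |iteratedDeriv 3 f x / iteratedDeriv 2 f x|)) ∧
    Tendsto (fun Δx : ℝ =>
        wenoTau f (x - Δx) Δx /
          ((wenoTau f (x - Δx) Δx + wenoBetaBar f (x - Δx) Δx) * Δx))
      (𝓝[>] 0)
      (𝓝 ((52 / 25) * |iteratedDeriv 3 f x / iteratedDeriv 2 f x|)) ∧
    (∃ C > (0 : ℝ), ∃ δ > (0 : ℝ), ∀ Δx : ℝ, 0 < Δx → Δx < δ →
      |wenoTau f x Δx / (wenoTau f x Δx + wenoBetaBar f x Δx)| ≤ C * Δx ∧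
      |wenoTau f (x - Δx) Δx / (wenoTau f (x - Δx) Δx + wenoBetaBar f (x - Δx) Δx)|
        ≤ C * Δx) := by
  obtain ⟨s, hs, hs0, hf'⟩ := weno_taylor_s13 f hf x h1
  generalize iteratedDeriv 2 f x = a at *
  generalize iteratedDeriv 3 f x = b at *
  have hk : ∀ k : ℝ, ContinuousAt (fun h => s (k * h)) 0 := fun k =>
    ContinuousAt.comp (f := fun h : ℝ => k * h) (g := s) (by simpa using hs) (by fun_prop)
  have A : ∀ k h : ℝ, f (x + k * h) = f x + h ^ 2 * (a / 2 * k ^ 2 + h * (k ^ 3 * s (k * h))) := by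
    intro k h
    rw [hf']; ring
  have c1 := hk 1
  have c2 := hk 2
  have d1 := hk (-1)
  have d2 := hk (-2)
  have d3 := hk (-3)
  have R : Tendsto (fun Δx : ℝ =>
        wenoTau f x Δx / ((wenoTau f x Δx + wenoBetaBar f x Δx) * Δx))
      (𝓝[>] 0) (𝓝 (4 * |b / a|)) := by
    -- differences
    let U0 : ℝ → ℝ := fun h => -8 * s (-2 * h) + 4 * s (-1 * h)
    let V0 : ℝ → ℝ := fun h => -8 * s (-2 * h) + 2 * s (-1 * h)
    let U1 : ℝ → ℝ := fun h => s (1 * h) + s (-1 * h)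
    let V1 : ℝ → ℝ := fun h => s (1 * h) - s (-1 * h)
    let U2 : ℝ → ℝ := fun h => 8 * s (2 * h) - 4 * s (1 * h)
    let V2 : ℝ → ℝ := fun h => 8 * s (2 * h) - 2 * s (1 * h)
    have kU0 : ContinuousAt U0 0 := (continuousAt_const.mul d2).add (continuousAt_const.mul d1)
    have kV0 : ContinuousAt V0 0 := (continuousAt_const.mul d2).add (continuousAt_const.mul d1)
    have kU1 : ContinuousAt U1 0 := c1.add d1
    have kV1 : ContinuousAt V1 0 := c1.sub d1
    have kU2 : ContinuousAt U2 0 := (continuousAt_const.mul c2).sub (continuousAt_const.mul c1)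
    have kV2 : ContinuousAt V2 0 := (continuousAt_const.mul c2).sub (continuousAt_const.mul c1)
    have hm1 := fun h : ℝ => (congrArg f (show x - h = x + (-1) * h by ring)).trans (A (-1) h)
    have hm2 := fun h : ℝ => (congrArg f (show x - 2 * h = x + (-2) * h by ring)).trans (A (-2) h)
    have hp1 := fun h : ℝ => (congrArg f (show x + h = x + 1 * h by ring)).trans (A 1 h)
    have hp2 := fun h : ℝ => A 2 h
    have key := weno_limit (fun h => wenoTau f x h) (fun h => wenoBetaBar f x h)
      (fun h => 1 / 4 * h * ((U2 h) ^ 2 - (U0 h) ^ 2)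
        + 13 / 12 * (2 * a * (V2 h - V0 h) + h * ((V2 h) ^ 2 - (V0 h) ^ 2)))
      (fun h => 1 / 3 * (1 / 4 * h ^ 2 * ((U0 h) ^ 2 + (U1 h) ^ 2 + (U2 h) ^ 2)
        + 13 / 12 * ((a + h * V0 h) ^ 2 + (a + h * V1 h) ^ 2 + (a + h * V2 h) ^ 2)))
      (by fun_prop) (by fun_prop) (by simp only [zero_mul, mul_zero, add_zero, zero_add, ne_eq, OfNat.ofNat_ne_zero, not_false_eq_true, zero_pow]; positivity)
      (fun h => by
        simp only [wenoTau, wenoBeta, hm1, hm2, hp1, hp2, U0, V0, U2, V2]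
        congr 1; ring)
      (fun h => by
        simp only [wenoBetaBar, wenoBeta, hm1, hm2, hp1, hp2, U0, V0, U1, V1, U2, V2]
        ring)
    convert key using 2
    simp only [U0, V0, U1, V1, U2, V2, mul_zero, hs0]
    have e : ∀ p : ℝ, p = (13 / 3 * a ^ 2) * (b / a) →
        4 * |b / a| = |p| / (13 / 12 * a ^ 2) := by
      rintro _ rfl
      rw [abs_mul, abs_of_nonneg (show 0 ≤ 13 / 3 * a ^ 2 by positivity)]
      field_simp
      ring
    rw [e _ _]
    · congr 1
      ring
    · field_simp
      ring
  have L : Tendsto (fun Δx : ℝ =>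
        wenoTau f (x - Δx) Δx /
          ((wenoTau f (x - Δx) Δx + wenoBetaBar f (x - Δx) Δx) * Δx))
      (𝓝[>] 0) (𝓝 ((52 / 25) * |b / a|)) := by
    let U0 : ℝ → ℝ := fun h => -27 * s (-3 * h) + 32 * s (-2 * h) - 3 * s (-1 * h)
    let V0 : ℝ → ℝ := fun h => -27 * s (-3 * h) + 16 * s (-2 * h) - s (-1 * h)
    let U1 : ℝ → ℝ := fun h => 8 * s (-2 * h)
    let V1 : ℝ → ℝ := fun h => -8 * s (-2 * h) + 2 * s (-1 * h)
    let U2 : ℝ → ℝ := fun h => -3 * s (-1 * h) + s (1 * h)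
    let V2 : ℝ → ℝ := fun h => -s (-1 * h) + s (1 * h)
    have kU0 : ContinuousAt U0 0 := ((continuousAt_const.mul d3).add (continuousAt_const.mul d2)).sub (continuousAt_const.mul d1)
    have kV0 : ContinuousAt V0 0 := ((continuousAt_const.mul d3).add (continuousAt_const.mul d2)).sub d1
    have kU1 : ContinuousAt U1 0 := continuousAt_const.mul d2
    have kV1 : ContinuousAt V1 0 := (continuousAt_const.mul d2).add (continuousAt_const.mul d1)
    have kU2 : ContinuousAt U2 0 := (continuousAt_const.mul d1).add c1
    have kV2 : ContinuousAt V2 0 := d1.neg.add c1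
    have hm1 := fun h : ℝ => (congrArg f (show x - h = x + (-1) * h by ring)).trans (A (-1) h)
    have hm2 := fun h : ℝ => (congrArg f (show x - h - h = x + (-2) * h by ring)).trans (A (-2) h)
    have hm3 := fun h : ℝ => (congrArg f (show x - h - 2 * h = x + (-3) * h by ring)).trans (A (-3) h)
    have hp0 : ∀ h, f (x - h + h) = f x := fun h => by
      rw [show x - h + h = x by ring]
    have hp1 := fun h : ℝ => (congrArg f (show x - h + 2 * h = x + 1 * h by ring)).trans (A 1 h)
    have key := weno_limit (fun h => wenoTau f (x - h) h) (fun h => wenoBetaBar f (x - h) h)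
      (fun h => 1 / 4 * (4 * a * (U2 h + U0 h) + h * ((U2 h) ^ 2 - (U0 h) ^ 2))
        + 13 / 12 * (2 * a * (V2 h - V0 h) + h * ((V2 h) ^ 2 - (V0 h) ^ 2)))
      (fun h => 1 / 3 * (1 / 4 * ((-2 * a + h * U0 h) ^ 2 + (-2 * a + h * U1 h) ^ 2 + (2 * a + h * U2 h) ^ 2)
        + 13 / 12 * ((a + h * V0 h) ^ 2 + (a + h * V1 h) ^ 2 + (a + h * V2 h) ^ 2)))
      (by fun_prop) (by fun_prop) (by simp only [zero_mul, add_zero]; positivity)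
      (fun h => by
        simp only [wenoTau, wenoBeta, hm3, hm2, hm1, hp0, hp1, U0, V0, U2, V2]
        congr 1; ring)
      (fun h => by
        simp only [wenoBetaBar, wenoBeta, hm3, hm2, hm1, hp0, hp1, U0, V0, U1, V1, U2, V2]
        ring)
    convert key using 2
    have e : ∀ p : ℝ, p = (13 / 3 * a ^ 2) * (b / a) →
        52 / 25 * |b / a| = |p| / (25 / 12 * a ^ 2) := by
      rintro _ rfl
      rw [abs_mul, abs_of_nonneg (show 0 ≤ 13 / 3 * a ^ 2 by positivity)]
      field_simp
      ring
    simp only [U0, V0, U1, V1, U2, V2, mul_zero, hs0]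
    rw [e _ _]
    · congr 1
      ring
    · field_simp
      ring
  refine ⟨R, L, ?_⟩
  have E := (weno_bound _ _ _ R).and (weno_bound (fun h => wenoTau f (x - h) h)
    (fun h => wenoBetaBar f (x - h) h) _ L)
  obtain ⟨δ, hδ, H⟩ := mem_nhdsGT_iff_exists_Ioo_subset.1 E
  refine ⟨max (abs (4 * |b / a|) + 1) (abs (52 / 25 * |b / a|) + 1), by positivity, δ, hδ, ?_⟩
  intro h h0 hh
  obtain ⟨e1, e2⟩ := H ⟨h0, hh⟩
  exact ⟨e1.trans (mul_le_mul_of_nonneg_right (le_max_left _ _) h0.le),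
    e2.trans (mul_le_mul_of_nonneg_right (le_max_right _ _) h0.le)⟩
end

section
/- Let f : ℝ → ℝ be infinitely differentiable and let x ∈ ℝ be a critical point of order 2, i.e. f′(x) = f″(x) = 0 and f‴(x) ≠ 0. Then the left-boundary WENO-ZC accelerating factor does not vanish in the limit: lim_{Δx → 0⁺} τ⁻(x,Δx)/(τ⁻(x,Δx) + β̄⁻(x,Δx)) = 156/227; in particular τ⁻/(τ⁻ + β̄⁻) = O(1) but not o(1), so the fifth-order accuracy condition cannot be satisfied by the WENO-ZC weights at second-order critical points for any exponent p. -/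
open Filter Topology

theorem weno_aux_s15 (f : ℝ → ℝ) (hf : ContDiff ℝ (⊤ : ℕ∞) f) (x : ℝ)
    (h1 : deriv f x = 0) (h2 : iteratedDeriv 2 f x = 0) (k : ℝ) (hk : k ≠ 0) :
    Tendsto (fun h : ℝ => (f (x + k * h) - f x) / h ^ 3) (𝓝[>] 0)
      (𝓝 (k ^ 3 * (iteratedDeriv 3 f x / 6))) := by
  have hf3 : ContDiff ℝ (3 : ℕ) f := hf.of_le (WithTop.coe_le_coe.2 le_top)
  have T := Real.taylor_tendsto (n := 3) convex_univ (Set.mem_univ x) hf3.contDiffOn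
  rw [nhdsWithin_univ] at T
  have hl : Tendsto (fun h : ℝ => x + k * h) (𝓝[>] 0) (𝓝 x) := by
    have : Tendsto (fun h : ℝ => x + k * h) (𝓝 0) (𝓝 (x + k * 0)) :=
      Continuous.tendsto (by fun_prop) 0
    simp only [mul_zero, add_zero] at this
    exact this.mono_left nhdsWithin_le_nhds
  have T2 := ((T.comp hl).const_mul (k ^ 3)).add_const (k ^ 3 * (iteratedDeriv 3 f x / 6))
  rw [mul_zero, zero_add] at T2
  refine T2.congr' ?_
  filter_upwards [self_mem_nhdsWithin] with h hh
  have hh' : h ≠ 0 := ne_of_gt hh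
  have e1 : iteratedDeriv 1 f x = 0 := by rw [iteratedDeriv_one]; exact h1
  simp only [Function.comp, taylor_within_apply, Finset.sum_range_succ, Finset.sum_range_zero,
    iteratedDerivWithin_univ, e1, h2, iteratedDeriv_zero, smul_eq_mul, add_sub_cancel_left]
  norm_num [Nat.factorial]
  field_simp
  ring

/-- at a second-order critical point (`f′(x) = f″(x) = 0`,
`f‴(x) ≠ 0`), the left-boundary accelerating factor does not vanish in the limit:
`τ⁻/(τ⁻ + β̄⁻) → 156/227` as `Δx → 0⁺`; in particular it is `O(1)` but not `o(1)`
(it does not tend to `0`). -/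
theorem weno_zc_accelerator_second_order_critical_point_minus
    (f : ℝ → ℝ) (hf : ContDiff ℝ (⊤ : ℕ∞) f) (x : ℝ)
    (h1 : deriv f x = 0) (h2 : iteratedDeriv 2 f x = 0)
    (h3 : iteratedDeriv 3 f x ≠ 0) :
    Tendsto (fun Δx : ℝ =>
        wenoTau f (x - Δx) Δx / (wenoTau f (x - Δx) Δx + wenoBetaBar f (x - Δx) Δx))
      (𝓝[>] 0) (𝓝 (156 / 227)) ∧
    ¬ Tendsto (fun Δx : ℝ =>
        wenoTau f (x - Δx) Δx / (wenoTau f (x - Δx) Δx + wenoBetaBar f (x - Δx) Δx))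
      (𝓝[>] 0) (𝓝 0) := by
  have key : Tendsto (fun Δx : ℝ =>
        wenoTau f (x - Δx) Δx / (wenoTau f (x - Δx) Δx + wenoBetaBar f (x - Δx) Δx))
      (𝓝[>] 0) (𝓝 (156 / 227)) := by
    have A := weno_aux_s15 f hf x h1 h2 (-3) (by norm_num)
    have B := weno_aux_s15 f hf x h1 h2 (-2) (by norm_num)
    have C := weno_aux_s15 f hf x h1 h2 (-1) (by norm_num)
    have D := weno_aux_s15 f hf x h1 h2 1 (by norm_num)
    set c := iteratedDeriv 3 f x / 6 with hc
    have hc0 : c ≠ 0 := div_ne_zero h3 (by norm_num)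
    set a := fun h : ℝ => (f (x + (-3) * h) - f x) / h ^ 3 with ha
    set b := fun h : ℝ => (f (x + (-2) * h) - f x) / h ^ 3 with hb
    set d := fun h : ℝ => (f (x + (-1) * h) - f x) / h ^ 3 with hd
    set e := fun h : ℝ => (f (x + 1 * h) - f x) / h ^ 3 with he
    have L0 := (((((A.sub (B.const_mul 4)).add (C.const_mul 3)).pow 2).const_mul (1 / 4)).add
      ((((A.sub (B.const_mul 2)).add C).pow 2).const_mul (13 / 12)))
    have L1 := (((B.pow 2).const_mul (1 / 4)).add
      (((B.sub (C.const_mul 2)).pow 2).const_mul (13 / 12)))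
    have L2 := (((((C.const_mul 3).add D).pow 2).const_mul (1 / 4)).add
      (((C.add D).pow 2).const_mul (13 / 12)))
    have N := (L2.sub L0).abs
    have S := ((L0.add L1).add L2).div_const 3
    have val : ∀ u v : ℝ, u = 156 * c ^ 2 → v = 71 * c ^ 2 → u + v ≠ 0 ∧
        u / (u + v) = 156 / 227 := by
      intro u v hu hv
      have : c ^ 2 ≠ 0 := pow_ne_zero 2 hc0
      have h' : u + v = 227 * c ^ 2 := by rw [hu, hv]; ring
      rw [h', hu]
      refine ⟨by positivity, ?_⟩
      field_simp
    have N' : |1 / 4 * (3 * ((-1) ^ 3 * c) + 1 ^ 3 * c) ^ 2 +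
        13 / 12 * ((-1) ^ 3 * c + 1 ^ 3 * c) ^ 2 -
        (1 / 4 * ((-3) ^ 3 * c - 4 * ((-2) ^ 3 * c) + 3 * ((-1) ^ 3 * c)) ^ 2 +
        13 / 12 * ((-3) ^ 3 * c - 2 * ((-2) ^ 3 * c) + (-1) ^ 3 * c) ^ 2)| = 156 * c ^ 2 := by
      rw [abs_of_nonpos]
      · ring
      · nlinarith [sq_nonneg c]
    have V := val _ (((1 / 4 * ((-3) ^ 3 * c - 4 * ((-2) ^ 3 * c) + 3 * ((-1) ^ 3 * c)) ^ 2 +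
        13 / 12 * ((-3) ^ 3 * c - 2 * ((-2) ^ 3 * c) + (-1) ^ 3 * c) ^ 2) +
        (1 / 4 * ((-2) ^ 3 * c) ^ 2 + 13 / 12 * ((-2) ^ 3 * c - 2 * ((-1) ^ 3 * c)) ^ 2) +
        (1 / 4 * (3 * ((-1) ^ 3 * c) + 1 ^ 3 * c) ^ 2 +
        13 / 12 * ((-1) ^ 3 * c + 1 ^ 3 * c) ^ 2)) / 3) N' (by ring)
    have Q := N.div (N.add S) V.1
    rw [V.2] at Q
    refine Q.congr' ?_
    filter_upwards [self_mem_nhdsWithin] with h hh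
    have hh' : h ≠ 0 := ne_of_gt hh
    have fa : f (x - h - 2 * h) = f x + h ^ 3 * a h := by
      rw [show x - h - 2 * h = x + (-3) * h by ring, ha]; field_simp; ring
    have fb : f (x - h - h) = f x + h ^ 3 * b h := by
      rw [show x - h - h = x + (-2) * h by ring, hb]; field_simp; ring
    have fd : f (x - h) = f x + h ^ 3 * d h := by
      rw [show x - h = x + (-1) * h by ring, hd]; field_simp; ring
    have f0 : f (x - h + h) = f x := by
      rw [sub_add_cancel]
    have fe : f (x - h + 2 * h) = f x + h ^ 3 * e h := by
      rw [show x - h + 2 * h = x + 1 * h by ring, he]; field_simp; ring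
    have h6 : (h ^ 6) ≠ 0 := pow_ne_zero 6 hh'
    simp only [wenoTau, wenoBetaBar, wenoBeta, fa, fb, fd, f0, fe]
    have tau : ∀ p q p' q' r r' : ℝ, p = h ^ 6 * p' → q = h ^ 6 * q' → r = h ^ 6 * r' →
        |p' - q'| / (|p' - q'| + (q' + r' + p') / 3) =
        |p - q| / (|p - q| + (q + r + p) / 3) := by
      rintro p q p' q' r r' rfl rfl rfl
      have e1 : |h ^ 6 * p' - h ^ 6 * q'| = h ^ 6 * |p' - q'| := by
        rw [← mul_sub, abs_mul, abs_of_pos (by have : 0 < h := hh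
                                               positivity)]
      rw [e1, ← mul_add, ← mul_add, mul_div_assoc (h ^ 6) (q' + r' + p') 3, ← mul_add,
        mul_div_mul_left _ _ h6]
    refine tau _ _ _ _ _ _ ?_ ?_ ?_ <;> ring
  refine ⟨key, fun h => ?_⟩
  have := tendsto_nhds_unique key h
  norm_num at this
end
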